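/- Let a = ξ_0 < ξ_1 < ⋯ < ξ_{p+1} = b be a partition of [a,b], and for each n = 0,…,p let f_n be N times continuously differentiable on [ξ_n, ξ_{n+1}] with Σ_{j=0}^N p_j(x) f_n^{(j)}(x) = 0 for all x ∈ [ξ_n, ξ_{n+1}]. Define m_k = Σ_{n=0}^p ∫_{ξ_n}^{ξ_{n+1}} x^k f_n(x) dx for k ≥ 0 and m_k = 0 for k < 0. Let ã_{i,j} denote the coefficient of x^i in the polynomial (∏_{n=1}^p (x − ξ_n)^N) · p_j(x), for 0 ≤ i ≤ d_j + Np. Then for every k ∈ ℕ: Σ_{r=0}^N Σ_{s=0}^N binom(N,r) binom(N,s) (−a)^{N−r} (−b)^{N−s} Σ_{j=0}^N Σ_{i=0}^{d_j+Np} ã_{i,j} (−1)^j (i+k+r+s)_j · m_{k+r+s+i−j} = 0. -/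

import Mathlib

open Finset intervalIntegral Polynomial

/-- The falling factorial `(x)_j = x(x−1)⋯(x−j+1)`, with `(x)_0 = 1`. -/
noncomputable def fallingFactorial (x : ℝ) (j : ℕ) : ℝ :=
  ∏ l ∈ Finset.range j, (x - l)

theorem integral_eval_mul_iteratedDerivWithin {u v : ℝ} (huv : u < v) {f : ℝ → ℝ} (j : ℕ)
    (hf : ContDiffOn ℝ j f (Set.Icc u v)) (Q : ℝ[X])
    (hu : (X - C u) ^ j ∣ Q) (hv : (X - C v) ^ j ∣ Q) :
    ∫ x in u..v, Q.eval x * iteratedDerivWithin j f (Set.Icc u v) x =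
      (-1) ^ j * ∫ x in u..v, (derivative^[j] Q).eval x * f x := by
  induction j generalizing Q with
  | zero => simp
  | succ j ih =>
    have hS : UniqueDiffOn ℝ (Set.Icc u v) := uniqueDiffOn_Icc huv
    have hc (i : ℕ) (hi : i ≤ j + 1) :
        ContinuousOn (iteratedDerivWithin i f (Set.Icc u v)) (Set.uIcc u v) := by
      rw [Set.uIcc_of_le huv.le]
      exact hf.continuousOn_iteratedDerivWithin (by exact_mod_cast hi) hS
    have hroot (w : ℝ) (hw : (X - C w) ^ (j + 1) ∣ Q) : Q.eval w = 0 :=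
      dvd_iff_isRoot.1 ((dvd_pow_self _ j.succ_ne_zero).trans hw)
    have hparts := integral_mul_deriv_eq_deriv_mul_of_hasDerivAt
      (u := fun x => Q.eval x) (u' := fun x => Q.derivative.eval x)
      (v := iteratedDerivWithin j f (Set.Icc u v))
      (v' := iteratedDerivWithin (j + 1) f (Set.Icc u v)) (a := u) (b := v)
      Q.continuous.continuousOn (hc j j.le_succ) (fun x _ => Q.hasDerivAt x)
      (fun x hx => by
        rw [min_eq_left huv.le, max_eq_right huv.le] at hx
        have hd := hf.differentiableOn_iteratedDerivWithin (m := j)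
          (by exact_mod_cast j.lt_succ_self) hS x (Set.Ioo_subset_Icc_self hx)
        rw [iteratedDerivWithin_succ]
        exact hd.hasDerivWithinAt.hasDerivAt (Icc_mem_nhds hx.1 hx.2))
      (Q.derivative.continuous.intervalIntegrable _ _)
      (hc (j + 1) le_rfl).intervalIntegrable
    have hle : (j : WithTop ℕ∞) ≤ ((j + 1 : ℕ) : WithTop ℕ∞) := by exact_mod_cast j.le_succ
    have hder (w : ℝ) (hw : (X - C w) ^ (j + 1) ∣ Q) : (X - C w) ^ j ∣ derivative Q := by
      simpa using pow_sub_one_dvd_derivative_of_pow_dvd hw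
    rw [hparts, hroot u hu, hroot v hv, ih (hf.of_le hle) _ (hder u hu) (hder v hv),
      Function.iterate_succ_apply]
    ring

theorem fallingFactorial_natCast (n j : ℕ) :
    fallingFactorial n j = (n.descFactorial j : ℝ) := by
  induction j with
  | zero => simp [fallingFactorial]
  | succ j ih =>
    rw [fallingFactorial, Finset.prod_range_succ, ← fallingFactorial, ih,
      Nat.descFactorial_succ, Nat.cast_mul, mul_comm]
    rcases le_or_gt j n with h | h
    · rw [Nat.cast_sub h]
    · simp [Nat.descFactorial_of_lt h]

/-- A linear functional on polynomials sends the `j`-th derivative of a monomial to the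
corresponding moment, whatever the moments of negative order are. -/
theorem map_iterate_derivative_X_pow (L : ℝ[X] →ₗ[ℝ] ℝ) {m : ℤ → ℝ}
    (hL : ∀ k : ℕ, L (X ^ k) = m k) (n j : ℕ) :
    L (derivative^[j] (X ^ n)) = fallingFactorial n j * m ((n : ℤ) - j) := by
  rw [iterate_derivative_X_pow_eq_smul, fallingFactorial_natCast]
  rcases le_or_gt j n with h | h
  · rw [← Nat.cast_sub h, ← hL, map_smul, smul_eq_mul]
  · simp [Nat.descFactorial_of_lt h]

/-- The sum over the pieces of the integral of a polynomial against the piece. -/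
noncomputable def piecewiseIntegral (p : ℕ) (ξ : ℕ → ℝ) (F : ℕ → ℝ → ℝ)
    (hF : ∀ n ≤ p, IntervalIntegrable (F n) MeasureTheory.volume (ξ n) (ξ (n + 1))) :
    ℝ[X] →ₗ[ℝ] ℝ where
  toFun P := ∑ n ∈ Finset.range (p + 1), ∫ x in (ξ n)..(ξ (n + 1)), P.eval x * F n x
  map_add' P Q := by
    rw [← Finset.sum_add_distrib]
    refine Finset.sum_congr rfl fun n hn => ?_
    have h := hF n (Nat.lt_succ_iff.1 (Finset.mem_range.1 hn))
    rw [← integral_add (h.continuousOn_mul P.continuous.continuousOn)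
      (h.continuousOn_mul Q.continuous.continuousOn)]
    simp [add_mul]
  map_smul' c P := by
    simp [mul_assoc, Finset.mul_sum]

theorem X_sub_C_pow_eq_sum (c : ℝ) (N : ℕ) :
    (X - C c) ^ N =
      ∑ r ∈ Finset.range (N + 1), C ((N.choose r : ℝ) * (-c) ^ (N - r)) * X ^ r := by
  rw [sub_eq_add_neg, ← C_neg, add_pow]
  refine Finset.sum_congr rfl fun r _ => ?_
  rw [C_mul, C_pow, C_eq_natCast]
  ring

theorem piecewise_moment_recurrence_diffop_form (a b : ℝ) (hab : a < b)
    (N : ℕ) (hN : 1 ≤ N)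
    (d : ℕ → ℕ) (A : ℕ → ℕ → ℝ) (p : ℕ) (ξ : ℕ → ℝ)
    (hξa : ξ 0 = a) (hξb : ξ (p + 1) = b)
    (hξmono : ∀ n ≤ p, ξ n < ξ (n + 1))
    (F : ℕ → ℝ → ℝ)
    (hF : ∀ n ≤ p, ContDiffOn ℝ (N : ℕ) (F n) (Set.Icc (ξ n) (ξ (n + 1))))
    (hode : ∀ n ≤ p, ∀ x ∈ Set.Icc (ξ n) (ξ (n + 1)),
      ∑ j ∈ Finset.range (N + 1),
        (∑ i ∈ Finset.range (d j + 1), A i j * x ^ i) *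
          iteratedDerivWithin j (F n) (Set.Icc (ξ n) (ξ (n + 1))) x = 0)
    (m : ℤ → ℝ)
    (hm : ∀ k : ℕ, m k = ∑ n ∈ Finset.range (p + 1),
      ∫ x in (ξ n)..(ξ (n + 1)), x ^ k * F n x)
    (hm0 : ∀ k : ℤ, k < 0 → m k = 0)
    (At : ℕ → ℕ → ℝ)
    (hAt : ∀ i j, At i j =
      ((∏ n ∈ Finset.Icc 1 p, (Polynomial.X - Polynomial.C (ξ n)) ^ N) *
        (∑ i' ∈ Finset.range (d j + 1), Polynomial.C (A i' j) * Polynomial.X ^ i')).coeff i) :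
    ∀ k : ℕ, ∑ r ∈ Finset.range (N + 1), ∑ s ∈ Finset.range (N + 1),
      (N.choose r : ℝ) * (N.choose s : ℝ) * (-a) ^ (N - r) * (-b) ^ (N - s) *
        ∑ j ∈ Finset.range (N + 1), ∑ i ∈ Finset.range (d j + N * p + 1),
          At i j * (-1) ^ j * fallingFactorial ((i : ℝ) + k + r + s) j *
            m ((k : ℤ) + r + s + i - j) = 0 := by
  intro k
  have hcont (n : ℕ) (hn : n ≤ p) : ContinuousOn (F n) (Set.uIcc (ξ n) (ξ (n + 1))) := by
    rw [Set.uIcc_of_le (hξmono n hn).le]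
    exact (hF n hn).continuousOn
  set L := piecewiseIntegral p ξ F fun n hn => (hcont n hn).intervalIntegrable with hLdef
  have hL (k : ℕ) : L (X ^ k) = m k := by
    rw [hm, hLdef]
    simp [piecewiseIntegral]
  set P : ℕ → ℝ[X] := fun j => ∑ i ∈ Finset.range (d j + 1), C (A i j) * X ^ i with hP
  set G : ℝ[X] := ∏ n ∈ Finset.Icc 1 p, (X - C (ξ n)) ^ N with hG
  set W : ℝ[X] := X ^ k * (X - C a) ^ N * (X - C b) ^ N * G with hW
  have hdvd (n : ℕ) (hn : n ≤ p + 1) : (X - C (ξ n)) ^ N ∣ W := by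
    rcases Nat.eq_zero_or_pos n with rfl | h0
    · rw [hξa]
      exact ⟨X ^ k * (X - C b) ^ N * G, by rw [hW]; ring⟩
    rcases Nat.lt_or_ge p n with h1 | h1
    · obtain rfl : n = p + 1 := by omega
      rw [hξb]
      exact ⟨X ^ k * (X - C a) ^ N * G, by rw [hW]; ring⟩
    · exact (Finset.dvd_prod_of_mem (fun n => (X - C (ξ n)) ^ N)
        (Finset.mem_Icc.2 ⟨h0, h1⟩)).mul_left _
  have hzero : ∑ j ∈ Finset.range (N + 1), (-1) ^ j * L (derivative^[j] (W * P j)) = 0 := by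
    simp only [hLdef, piecewiseIntegral, LinearMap.coe_mk, AddHom.coe_mk, Finset.mul_sum]
    rw [Finset.sum_comm]
    refine Finset.sum_eq_zero fun n hn => ?_
    have hnp : n ≤ p := Nat.lt_succ_iff.1 (Finset.mem_range.1 hn)
    have hlt := hξmono n hnp
    have hint (j : ℕ) (hj : j ∈ Finset.range (N + 1)) : (-1) ^ j *
        ∫ x in (ξ n)..(ξ (n + 1)), (derivative^[j] (W * P j)).eval x * F n x =
        ∫ x in (ξ n)..(ξ (n + 1)), (W * P j).eval x *
          iteratedDerivWithin j (F n) (Set.Icc (ξ n) (ξ (n + 1))) x := by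
      have hjN : j ≤ N := Nat.lt_succ_iff.1 (Finset.mem_range.1 hj)
      rw [integral_eval_mul_iteratedDerivWithin hlt j
        ((hF n hnp).of_le (by exact_mod_cast hjN)) _
        (((pow_dvd_pow _ hjN).trans (hdvd n (by omega))).mul_right _)
        (((pow_dvd_pow _ hjN).trans (hdvd (n + 1) (by omega))).mul_right _)]
    rw [Finset.sum_congr rfl hint, ← integral_finsetSum]
    · rw [integral_congr (g := fun _ => (0 : ℝ)), integral_zero]
      intro x hx
      rw [Set.uIcc_of_le hlt.le] at hx
      have := hode n hnp x hx
      simp only [hP, eval_mul, eval_finsetSum, eval_C, eval_pow, eval_X, mul_assoc (W.eval x)]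
      rw [← Finset.mul_sum, this, mul_zero]
    · intro j hj
      have hjN : j ≤ N := Nat.lt_succ_iff.1 (Finset.mem_range.1 hj)
      refine ContinuousOn.intervalIntegrable ?_
      refine (W * P j).continuous.continuousOn.mul ?_
      rw [Set.uIcc_of_le hlt.le]
      exact (hF n hnp).continuousOn_iteratedDerivWithin (by exact_mod_cast hjN)
        (uniqueDiffOn_Icc hlt)
  have hGdeg : G.natDegree ≤ N * p := by
    refine (natDegree_prod_le _ _).trans ?_
    refine (Finset.sum_le_card_nsmul _ _ N fun n _ => ?_).trans ?_
    · simp [natDegree_pow]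
    · simp [mul_comm]
  have hPdeg (j : ℕ) : (P j).natDegree ≤ d j :=
    natDegree_sum_le_of_forall_le _ _ fun i hi =>
      (natDegree_C_mul_X_pow_le _ _).trans (Nat.lt_succ_iff.1 (Finset.mem_range.1 hi))
  have hGP (j : ℕ) :
      G * P j = ∑ i ∈ Finset.range (d j + N * p + 1), C (At i j) * X ^ i := by
    have hdeg : (G * P j).natDegree < d j + N * p + 1 := by
      have := natDegree_mul_le (p := G) (q := P j)
      have := hPdeg j
      omega
    rw [(G * P j).as_sum_range_C_mul_X_pow' hdeg]
    exact Finset.sum_congr rfl fun i _ => by rw [hAt]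
  have hexp (j : ℕ) : (-1) ^ j * L (derivative^[j] (W * P j)) =
      ∑ r ∈ Finset.range (N + 1), ∑ s ∈ Finset.range (N + 1),
        (N.choose r : ℝ) * (N.choose s : ℝ) * (-a) ^ (N - r) * (-b) ^ (N - s) *
          ∑ i ∈ Finset.range (d j + N * p + 1),
            At i j * (-1) ^ j * fallingFactorial ((i : ℝ) + k + r + s) j *
              m ((k : ℤ) + r + s + i - j) := by
    have hWP : W * P j = ∑ r ∈ Finset.range (N + 1), ∑ s ∈ Finset.range (N + 1),
        ∑ i ∈ Finset.range (d j + N * p + 1),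
          C (((N.choose r : ℝ) * (-a) ^ (N - r)) * ((N.choose s : ℝ) * (-b) ^ (N - s)) *
            At i j) * X ^ (i + k + r + s) := by
      rw [hW, mul_assoc, hGP, mul_assoc (X ^ k), X_sub_C_pow_eq_sum, X_sub_C_pow_eq_sum,
        Finset.sum_mul_sum, Finset.mul_sum _ _ (X ^ k), Finset.sum_mul]
      refine Finset.sum_congr rfl fun r _ => ?_
      rw [Finset.mul_sum _ _ (X ^ k), Finset.sum_mul]
      refine Finset.sum_congr rfl fun s _ => ?_
      rw [Finset.mul_sum]
      refine Finset.sum_congr rfl fun i _ => ?_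
      simp only [C_mul]
      ring
    rw [hWP]
    simp only [iterate_derivative_sum, map_sum, ← smul_eq_C_mul, iterate_derivative_smul,
      map_smul, map_iterate_derivative_X_pow L hL, Finset.mul_sum, smul_eq_mul]
    refine Finset.sum_congr rfl fun r _ => Finset.sum_congr rfl fun s _ =>
      Finset.sum_congr rfl fun i _ => ?_
    push_cast
    rw [show (i : ℤ) + k + r + s - j = k + r + s + i - j by ring]
    ring
  rw [Finset.sum_congr rfl fun j _ => hexp j, Finset.sum_comm] at hzero
  refine Eq.trans (Eq.symm ?_) hzero
  refine Finset.sum_congr rfl fun r _ => ?_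
  rw [Finset.sum_comm]
  refine Finset.sum_congr rfl fun s _ => ?_
  rw [Finset.mul_sum]
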